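/- Pairwise-Nash property for k = n (Proposition 2, part 2): every Nash equilibrium S in an n-stable network (NEnSN) is a pairwise-Nash network: (a) S is pairwise stable (for links g_{ij} = 1 both Δ_{g_{ij}} u_i(S) ≥ 0 and Δ_{g_{ij}} u_j(S) ≥ 0; for non-links not both Δ_{g_{ij}} u_i(S) > 0 and Δ_{g_{ij}} u_j(S) ≥ 0), and (b) no agent has a profitable unilateral deviation consisting of changing her own action and deleting any subset of her links: for every agent i, every a'_i ∈ {0,1}, and every subset D ⊆ {j : g_{ij} = 1}, the state S' obtained from S by setting a_i := a'_i and g_{ij} = g_{ji} := 0 for all j ∈ D satisfies u_i(S') ≤ u_i(S). -/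

import Mathlib

open Finset

namespace NEkSN

/-- A network state: a profile of binary actions together with a symmetric,
loopless adjacency matrix of friendship links. -/
abbrev NetState (n : ℕ) :=
  {S : (Fin n → Bool) × (Fin n → Fin n → Bool) //
    (∀ i j, S.2 i j = S.2 j i) ∧ ∀ i, S.2 i i = false}

variable {n : ℕ}

noncomputable section

/-- The (real-valued) action of agent `i`. -/
def act (S : NetState n) (i : Fin n) : ℝ := if S.1.1 i then 1 else 0

/-- The (real-valued) link indicator between `i` and `j`. -/
def lnk (S : NetState n) (i j : Fin n) : ℝ := if S.1.2 i j then 1 else 0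

/-- Agent `i`'s utility. -/
def util (v : Fin n → ℝ) (w : Fin n → Fin n → ℝ) (q : Fin n → Fin n → Fin n → ℝ)
    (h φ : ℝ) (i : Fin n) (S : NetState n) : ℝ :=
  act S i * v i
    + ∑ j ∈ univ.erase i, lnk S i j * w i j
    + ∑ j ∈ univ.erase i, ∑ k ∈ univ.erase i,
        (if j < k then q i j k * lnk S i j * lnk S j k * lnk S k i else 0)
    + h * act S i * ∑ j ∈ univ.erase i, act S j
    + φ * ∑ j ∈ univ.erase i,
        lnk S i j * (act S i * act S j + (1 - act S i) * (1 - act S j))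

/-- The potential function. -/
def potential (v : Fin n → ℝ) (w : Fin n → Fin n → ℝ) (q : Fin n → Fin n → Fin n → ℝ)
    (h φ : ℝ) (S : NetState n) : ℝ :=
  (∑ i, act S i * v i)
    + (1 / 2) * ∑ i, ∑ j ∈ univ.erase i, lnk S i j * w i j
    + (h / 2) * ∑ i, ∑ j ∈ univ.erase i, act S i * act S j
    + (φ / 2) * ∑ i, ∑ j ∈ univ.erase i,
        lnk S i j * (act S i * act S j + (1 - act S i) * (1 - act S j))
    + ∑ i, ∑ j, ∑ k, (if i < j ∧ j < k then q i j k * lnk S i j * lnk S j k * lnk S k i else 0)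

/-- The state `S` with `i`'s action set to `b`. -/
def setAct (S : NetState n) (i : Fin n) (b : Bool) : NetState n :=
  ⟨(Function.update S.1.1 i b, S.1.2), S.2⟩

/-- The state `S` with the link between `i` and `j` (`i ≠ j`) set to `b`. -/
def setLink (S : NetState n) (i j : Fin n) (b : Bool) : NetState n :=
  ⟨(S.1.1, fun p q =>
      if p = q then false
      else if (p = i ∧ q = j) ∨ (p = j ∧ q = i) then b else S.1.2 p q), by
    refine ⟨fun p q => ?_, fun p => ?_⟩
    · by_cases hpq : p = q
      · simp [hpq]
      · have hqp : ¬q = p := fun hc => hpq hc.symm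
        simp only [if_neg hpq, if_neg hqp]
        by_cases hc : (p = i ∧ q = j) ∨ (p = j ∧ q = i)
        · rw [if_pos hc, if_pos (by tauto)]
        · rw [if_neg hc, if_neg (by tauto), S.2.1 p q]
    · simp⟩

/-- The state `S` with all links between `i` and members of `D` deleted. -/
def deleteLinks (S : NetState n) (i : Fin n) (D : Finset (Fin n)) : NetState n :=
  ⟨(S.1.1, fun p q => if (p = i ∧ q ∈ D) ∨ (q = i ∧ p ∈ D) then false else S.1.2 p q), by
    refine ⟨fun p q => ?_, fun p => ?_⟩
    · dsimp only
      by_cases hc : (p = i ∧ q ∈ D) ∨ (q = i ∧ p ∈ D)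
      · rw [if_pos hc, if_pos (by tauto)]
      · rw [if_neg hc, if_neg (by tauto), S.2.1 p q]
    · dsimp only
      split
      · rfl
      · exact S.2.2 p⟩

/-- Incremental utility of agent `i` from switching her action on. -/
def dActU (v : Fin n → ℝ) (w : Fin n → Fin n → ℝ) (q : Fin n → Fin n → Fin n → ℝ)
    (h φ : ℝ) (i : Fin n) (S : NetState n) : ℝ :=
  util v w q h φ i (setAct S i true) - util v w q h φ i (setAct S i false)

/-- Incremental potential from switching `i`'s action on. -/
def dActP (v : Fin n → ℝ) (w : Fin n → Fin n → ℝ) (q : Fin n → Fin n → Fin n → ℝ)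
    (h φ : ℝ) (i : Fin n) (S : NetState n) : ℝ :=
  potential v w q h φ (setAct S i true) - potential v w q h φ (setAct S i false)

/-- Incremental utility of agent `i` from the link with `j`. -/
def dLinkU (v : Fin n → ℝ) (w : Fin n → Fin n → ℝ) (q : Fin n → Fin n → Fin n → ℝ)
    (h φ : ℝ) (i j : Fin n) (S : NetState n) : ℝ :=
  util v w q h φ i (setLink S i j true) - util v w q h φ i (setLink S i j false)

/-- Incremental potential from the link between `i` and `j`. -/
def dLinkP (v : Fin n → ℝ) (w : Fin n → Fin n → ℝ) (q : Fin n → Fin n → Fin n → ℝ)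
    (h φ : ℝ) (i j : Fin n) (S : NetState n) : ℝ :=
  potential v w q h φ (setLink S i j true) - potential v w q h φ (setLink S i j false)

/-- A `k`-meeting: an agent `i` together with a set of `k - 1` other agents. -/
abbrev Meeting (n k : ℕ) :=
  {μ : Fin n × Finset (Fin n) // μ.1 ∉ μ.2 ∧ μ.2.card = k - 1}

/-- The `k`-neighborhood of `S` for meeting `μ = (i, I)`: all states agreeing with `S`
except possibly in `i`'s action and the links between `i` and members of `I`. -/
def nbhd {k : ℕ} (μ : Meeting n k) (S : NetState n) : Finset (NetState n) :=
  univ.filter fun S' =>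
    (∀ p, p ≠ μ.1.1 → S'.1.1 p = S.1.1 p) ∧
    (∀ p q, ¬((p = μ.1.1 ∧ q ∈ μ.1.2) ∨ (q = μ.1.1 ∧ p ∈ μ.1.2)) → S'.1.2 p q = S.1.2 p q)

/-- The feasible set for the decision problem of `μ.1` on the neighborhood of `S`:
states in the neighborhood satisfying the stability constraints. -/
def feasible (v : Fin n → ℝ) (w : Fin n → Fin n → ℝ) (q : Fin n → Fin n → Fin n → ℝ)
    (h φ : ℝ) {k : ℕ} (μ : Meeting n k) (S : NetState n) : Set (NetState n) :=
  {S' | S' ∈ nbhd μ S ∧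
    ∀ j ∈ μ.1.2, S'.1.2 μ.1.1 j = true → 0 ≤ dLinkU v w q h φ j μ.1.1 S'}

/-- Nash equilibrium in a `k`(-player) stable network. -/
def isNEkSN (v : Fin n → ℝ) (w : Fin n → Fin n → ℝ) (q : Fin n → Fin n → Fin n → ℝ)
    (h φ : ℝ) (k : ℕ) (S : NetState n) : Prop :=
  ∀ μ : Meeting n k,
    S ∈ feasible v w q h φ μ S ∧
    ∀ T ∈ feasible v w q h φ μ S, util v w q h φ μ.1.1 T ≤ util v w q h φ μ.1.1 S

/-- One-step transition kernel of the `k`-player consensual dynamic with logit shocks: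
`kernel … ρ S' S = P_k(S' | S)`. -/
def kernel (v : Fin n → ℝ) (w : Fin n → Fin n → ℝ) (q : Fin n → Fin n → Fin n → ℝ)
    (h φ : ℝ) (k : ℕ) (ρ : Meeting n k → ℝ) (S' S : NetState n) : ℝ :=
  ∑ μ : Meeting n k,
    if S' ∈ nbhd μ S then
      ρ μ * Real.exp (potential v w q h φ S') /
        ∑ T ∈ nbhd μ S, Real.exp (potential v w q h φ T)
    else 0

/-- The Gibbs (stationary) distribution `π(S) ∝ exp (Φ S)`. -/
def gibbs (v : Fin n → ℝ) (w : Fin n → Fin n → ℝ) (q : Fin n → Fin n → Fin n → ℝ)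
    (h φ : ℝ) (S : NetState n) : ℝ :=
  Real.exp (potential v w q h φ S) / ∑ T : NetState n, Real.exp (potential v w q h φ T)

/-- `m`-step transition probabilities of the `k`CD. -/
def kernelIter (v : Fin n → ℝ) (w : Fin n → Fin n → ℝ) (q : Fin n → Fin n → Fin n → ℝ)
    (h φ : ℝ) (k : ℕ) (ρ : Meeting n k → ℝ) : ℕ → NetState n → NetState n → ℝ
  | 0, S', S => if S' = S then 1 else 0
  | m + 1, S', S =>
      ∑ T : NetState n, kernel v w q h φ k ρ S' T * kernelIter v w q h φ k ρ m T S

/-- The eigenfunction `e_I` associated with a set `I` of coordinate pairs `(i, j)`, `i ≥ j`: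
`(i, i)` refers to the action `a_i` and `(i, j)` with `i > j` to the link `g_{ij}`. -/
def eig (I : Finset (Fin n × Fin n)) (S : NetState n) : ℝ :=
  ∏ p ∈ I,
    if p.1 = p.2 then (if S.1.1 p.1 then (-1 : ℝ) else 1)
    else (if S.1.2 p.1 p.2 then (-1 : ℝ) else 1)

/-- `I_i = {j ≠ i : (i, j) ∈ I or (j, i) ∈ I}`. -/
def linkedSet (I : Finset (Fin n × Fin n)) (i : Fin n) : Finset (Fin n) :=
  univ.filter fun j => j ≠ i ∧ ((i, j) ∈ I ∨ (j, i) ∈ I)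

/-- The eigenvalue `λ_{k,I}`. -/
def lam (k : ℕ) (I : Finset (Fin n × Fin n)) : ℝ :=
  (∑ i ∈ univ.filter (fun i : Fin n => (i, i) ∉ I),
      ((n - 1 - (linkedSet I i).card).choose (k - 1) : ℝ))
    / (n * ((n - 1).choose (k - 1) : ℝ))

/-- The one-flip neighborhood `N(S)`: states obtained from `S` by flipping exactly one
coordinate (one action or one link). -/
def flipNbhd (S : NetState n) : Set (NetState n) :=
  {S' | (∃ i, S' = setAct S i (!S.1.1 i)) ∨
        ∃ i j, i ≠ j ∧ S' = setLink S i j (!S.1.2 i j)}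

end



/-- Closed form of the incremental utility of a link. -/
theorem dLinkU_eq {n : ℕ} (v : Fin n → ℝ) (w : Fin n → Fin n → ℝ)
    (q : Fin n → Fin n → Fin n → ℝ)
    (hq2 : ∀ i j k, q i j k = q i k j)
    (h φ : ℝ) (S : NetState n) (i j : Fin n) (hij : i ≠ j) :
    dLinkU v w q h φ i j S = w i j + (∑ k, q i j k * lnk S i k * lnk S j k)
      + φ * (act S i * act S j + (1 - act S i) * (1 - act S j)) := by
  have hact : ∀ b p, act (setLink S i j b) p = act S p := fun b p => rfl
  have hsym : ∀ p r, lnk S p r = lnk S r p := fun p r => by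
    unfold lnk; rw [S.2.1 p r]
  have hd : ∀ p, lnk S p p = 0 := fun p => by unfold lnk; rw [S.2.2 p]; simp
  have hl : ∀ b p r, lnk (setLink S i j b) p r =
      if (p = i ∧ r = j) ∨ (p = j ∧ r = i) then (if b then 1 else 0) else lnk S p r := by
    intro b p r
    by_cases hpr : p = r
    · subst hpr
      have : ¬ ((p = i ∧ p = j) ∨ (p = j ∧ p = i)) := by
        rintro (⟨rfl, h2⟩ | ⟨rfl, h2⟩)
        · exact hij h2
        · exact hij h2.symm
      rw [if_neg this, hd]
      simp [lnk, setLink]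
    · simp only [lnk, setLink, if_neg hpr]
      split <;> rfl
  have hjmem : j ∈ univ.erase i := by simp [hij.symm]
  have h1 : ∀ c : Fin n → ℝ, (∑ p ∈ univ.erase i, lnk (setLink S i j true) i p * c p)
      - ∑ p ∈ univ.erase i, lnk (setLink S i j false) i p * c p = c j := by
    intro c
    rw [← Finset.sum_sub_distrib, Finset.sum_eq_single_of_mem j hjmem]
    · simp [hl]
    · intro p _ hp
      simp [hl, hp, hij]
  have h2 : (∑ p ∈ univ.erase i, ∑ r ∈ univ.erase i,
        (if p < r then q i p r * lnk (setLink S i j true) i p * lnk (setLink S i j true) p r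
          * lnk (setLink S i j true) r i else 0))
      - (∑ p ∈ univ.erase i, ∑ r ∈ univ.erase i,
        (if p < r then q i p r * lnk (setLink S i j false) i p * lnk (setLink S i j false) p r
          * lnk (setLink S i j false) r i else 0))
      = ∑ k, q i j k * lnk S i k * lnk S j k := by
    have hterm : ∀ p ∈ univ.erase i, ∀ r ∈ univ.erase i,
        (if p < r then q i p r * lnk (setLink S i j true) i p * lnk (setLink S i j true) p r
          * lnk (setLink S i j true) r i else 0)
        - (if p < r then q i p r * lnk (setLink S i j false) i p * lnk (setLink S i j false) p r
          * lnk (setLink S i j false) r i else 0)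
        = (if p = j then (if j < r then q i j r * lnk S i r * lnk S j r else 0) else 0)
          + (if r = j then (if p < j then q i j p * lnk S i p * lnk S j p else 0) else 0) := by
      intro p hp r hr
      have hp' : p ≠ i := by simpa using hp
      have hr' : r ≠ i := by simpa using hr
      by_cases hpj : p = j
      · subst hpj
        by_cases hrj : r = p
        · subst hrj; simp
        · simp only [hl, hp', hr', hrj, hij]
          by_cases hlt : p < r <;> simp [hlt, hsym r i] <;> ring
      · by_cases hrj : r = j
        · subst hrj
          simp only [hl, hp', hr', hpj, hij]
          by_cases hlt : p < r
          · simp [hlt, hsym r p, hq2 i p r]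
          · simp [hlt]
        · simp [hl, hp', hr', hpj, hrj]
    rw [← Finset.sum_sub_distrib]
    simp_rw [← Finset.sum_sub_distrib]
    rw [Finset.sum_congr rfl (fun p hp => Finset.sum_congr rfl (hterm p hp))]
    simp_rw [Finset.sum_add_distrib]
    have e1 : ∑ p ∈ univ.erase i, ∑ r ∈ univ.erase i,
        (if p = j then (if j < r then q i j r * lnk S i r * lnk S j r else 0) else 0)
        = ∑ r ∈ univ.erase i, (if j < r then q i j r * lnk S i r * lnk S j r else 0) := by
      rw [Finset.sum_eq_single_of_mem j hjmem]
      · simp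
      · intro p _ hp; simp [hp]
    have e2 : ∑ p ∈ univ.erase i, ∑ r ∈ univ.erase i,
        (if r = j then (if p < j then q i j p * lnk S i p * lnk S j p else 0) else 0)
        = ∑ p ∈ univ.erase i, (if p < j then q i j p * lnk S i p * lnk S j p else 0) := by
      refine Finset.sum_congr rfl fun p _ => ?_
      rw [Finset.sum_eq_single_of_mem j hjmem]
      · simp
      · intro r _ hr; simp [hr]
    rw [e1, e2, ← Finset.sum_add_distrib]
    rw [← Finset.add_sum_erase univ _ (Finset.mem_univ i)]
    rw [hd i]
    simp only [mul_zero, zero_mul, zero_add]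
    refine Finset.sum_congr rfl fun r _ => ?_
    rcases lt_trichotomy j r with hlt | heq | hgt
    · simp [hlt, hlt.le, not_lt.mpr hlt.le]
    · subst heq; simp [hd]
    · simp [hgt, not_lt.mpr hgt.le]
  have h3 := h1 (fun p => w i p)
  have h4 := h1 (fun p => act S i * act S p + (1 - act S i) * (1 - act S p))
  unfold dLinkU util
  simp only [hact]
  linear_combination h3 + h2 + φ * h4

theorem dLinkU_symm {n : ℕ} (v : Fin n → ℝ) (w : Fin n → Fin n → ℝ)
    (hw : ∀ i j, w i j = w j i) (q : Fin n → Fin n → Fin n → ℝ)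
    (hq1 : ∀ i j k, q i j k = q j i k) (hq2 : ∀ i j k, q i j k = q i k j)
    (h φ : ℝ) (S : NetState n) (i j : Fin n) (hij : i ≠ j) :
    dLinkU v w q h φ i j S = dLinkU v w q h φ j i S := by
  rw [dLinkU_eq v w q hq2 h φ S i j hij, dLinkU_eq v w q hq2 h φ S j i hij.symm, hw i j]
  have : ∑ k, q i j k * lnk S i k * lnk S j k = ∑ k, q j i k * lnk S j k * lnk S i k :=
    Finset.sum_congr rfl fun k _ => by rw [hq1 i j k]; ring
  rw [this]; ring

theorem setLink_self {n : ℕ} (S : NetState n) (i j : Fin n) (b : Bool)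
    (hb : S.1.2 i j = b) : setLink S i j b = S := by
  apply Subtype.ext
  refine Prod.ext rfl ?_
  funext p r
  show (if p = r then false
      else if (p = i ∧ r = j) ∨ (p = j ∧ r = i) then b else S.1.2 p r) = S.1.2 p r
  split_ifs with h1 h2
  · subst h1; exact (S.2.2 p).symm
  · rcases h2 with ⟨rfl, rfl⟩ | ⟨rfl, rfl⟩
    · exact hb.symm
    · rw [S.2.1]; exact hb.symm
  · rfl

/-- An NEnSN maximizes each agent's utility without the stability constraints. -/
theorem nensn_unconstrained {n : ℕ}
    (v : Fin n → ℝ) (w : Fin n → Fin n → ℝ) (hw : ∀ i j, w i j = w j i)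
    (q : Fin n → Fin n → Fin n → ℝ)
    (hq1 : ∀ i j k, q i j k = q j i k) (hq2 : ∀ i j k, q i j k = q i k j)
    (h φ : ℝ) (S : NetState n) (hS : isNEkSN v w q h φ n S) (i : Fin n) (T : NetState n)
    (hT1 : ∀ p, p ≠ i → T.1.1 p = S.1.1 p)
    (hT2 : ∀ p r, p ≠ i → r ≠ i → T.1.2 p r = S.1.2 p r) :
    util v w q h φ i T ≤ util v w q h φ i S := by
  let μ : Meeting n n := ⟨(i, univ.erase i), by simp, by simp⟩
  have hmem : ∀ U : NetState n, U ∈ nbhd μ S ↔ (∀ p, p ≠ i → U.1.1 p = S.1.1 p) ∧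
      (∀ p r, p ≠ i → r ≠ i → U.1.2 p r = S.1.2 p r) := by
    intro U
    simp only [nbhd, μ, Finset.mem_filter, Finset.mem_univ, true_and, Finset.mem_erase, and_true]
    refine and_congr_right fun _ => ⟨fun H p r hp hr => H p r (by tauto), fun H p r hpr => ?_⟩
    by_cases hp : p = i
    · by_cases hr : r = i
      · subst hp; subst hr; rw [U.2.2, S.2.2]
      · exact absurd (Or.inl ⟨hp, hr⟩) hpr
    · by_cases hr : r = i
      · exact absurd (Or.inr ⟨hr, hp⟩) hpr
      · exact H p r hp hr
  obtain ⟨M, hM, hmax⟩ := Finset.exists_max_image (nbhd μ S) (util v w q h φ i)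
    ⟨T, (hmem T).2 ⟨hT1, hT2⟩⟩
  have hf : M ∈ feasible v w q h φ μ S := by
    refine ⟨hM, fun j hj hlink => ?_⟩
    have hji : j ≠ i := by simpa [μ] using hj
    change 0 ≤ dLinkU v w q h φ j i M
    change M.1.2 i j = true at hlink
    rw [dLinkU_symm v w hw q hq1 hq2 h φ M j i hji]
    unfold dLinkU
    rw [setLink_self M i j true hlink, sub_nonneg]
    apply hmax
    rw [hmem] at hM ⊢
    refine ⟨hM.1, fun p r hp hr => ?_⟩
    rw [← hM.2 p r hp hr]
    show (if p = r then false
      else if (p = i ∧ r = j) ∨ (p = j ∧ r = i) then false else M.1.2 p r) = M.1.2 p r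
    split_ifs with h1 h2
    · subst h1; exact (M.2.2 p).symm
    · tauto
    · rfl
  exact (hmax T ((hmem T).2 ⟨hT1, hT2⟩)).trans ((hS μ).2 M hf)

/-- Proposition 2, part 2: every NEnSN is a pairwise-Nash network. -/
theorem nensn_pairwise_nash {n : ℕ} (hn : 2 ≤ n)
    (v : Fin n → ℝ) (w : Fin n → Fin n → ℝ) (hw : ∀ i j, w i j = w j i)
    (q : Fin n → Fin n → Fin n → ℝ)
    (hq1 : ∀ i j k, q i j k = q j i k) (hq2 : ∀ i j k, q i j k = q i k j)
    (h φ : ℝ) (S : NetState n) (hS : isNEkSN v w q h φ n S) :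
    ((∀ i j : Fin n, i ≠ j → S.1.2 i j = true →
        0 ≤ dLinkU v w q h φ i j S ∧ 0 ≤ dLinkU v w q h φ j i S) ∧
     (∀ i j : Fin n, i ≠ j → S.1.2 i j = false →
        ¬(0 < dLinkU v w q h φ i j S ∧ 0 ≤ dLinkU v w q h φ j i S))) ∧
    (∀ (i : Fin n) (b : Bool) (D : Finset (Fin n)),
        (∀ j ∈ D, S.1.2 i j = true) →
        util v w q h φ i (setAct (deleteLinks S i D) i b) ≤ util v w q h φ i S) := by
  have key := nensn_unconstrained v w hw q hq1 hq2 h φ S hS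
  have hset : ∀ i j b, util v w q h φ i (setLink S i j b) ≤ util v w q h φ i S := by
    intro i j b
    refine key i _ (fun _ _ => rfl) fun p r hp hr => ?_
    show (if p = r then false
      else if (p = i ∧ r = j) ∨ (p = j ∧ r = i) then b else S.1.2 p r) = S.1.2 p r
    split_ifs with h1 h2
    · subst h1; exact (S.2.2 p).symm
    · tauto
    · rfl
  have hpos : ∀ i j, S.1.2 i j = true → 0 ≤ dLinkU v w q h φ i j S := by
    intro i j hl
    unfold dLinkU
    rw [setLink_self S i j true hl, sub_nonneg]
    exact hset i j false
  refine ⟨⟨fun i j _ hl => ⟨hpos i j hl, hpos j i (by rw [S.2.1]; exact hl)⟩, ?_⟩, ?_⟩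
  · rintro i j _ hl ⟨h1, _⟩
    unfold dLinkU at h1
    rw [setLink_self S i j false hl] at h1
    linarith [hset i j true]
  · intro i b D _
    refine key i _ (fun p hp => ?_) fun p r hp hr => ?_
    · simp [setAct, deleteLinks, hp]
    · simp [setAct, deleteLinks, hp, hr]

end NEkSN
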